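/- Let (τ_n), (d_n) be sequences of nonnegative reals with (τ_n) nonincreasing and τ_n ≤ 1, and suppose that for all n ≥ 2 and 1 ≤ m < n one has τ_{2n} ≤ √(2n) · C_ζ (2n)^ζ · τ_n^{m/n} · d_m^{1−m/n} whenever m < n (the weak-greedy estimate with γ_n^{-1} ≤ C_ζ n^ζ). If additionally d_n ≤ C₀ n^{−α} for all n ≥ 1 with C₀, C_ζ, α, ζ > 0, then for every β > 1/2 there exists a constant C₁ (given explicitly by C₁ = max{ C₀ 2^{2α²/ζ} ((ζ+β)/(β−1/2))^α max(1, C_ζ^{(ζ+β)/ζ}), max_{1 ≤ n ≤ 2⌊2(ζ+β)⌋+1} n^{α−ζ−β} }) such that τ_n ≤ C₁ n^{−α+ζ+β} for all n ≥ 1. -/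

import Mathlib

/-- Coefficient inequality in logarithmic form, given the remainder inequality. -/
lemma aux_step (α ζ s δ c0 c1 cz L2 Lk Lm Ld Ln : ℝ)
    (hζ : 0 < ζ) (hαs : s < α) (hδ1 : δ < 1)
    (h1 : ζ ≤ (1 - δ) * s)
    (hc1 : c0 + 2 * α ^ 2 / ζ * L2 + α * Ld ≤ c1)
    (hc2 : c0 + 2 * α ^ 2 / ζ * L2 + α * Ld + s / ζ * cz ≤ c1)
    (hLn : Ln ≤ 2 * L2 + Lk)
    (hR : (ζ + 1 / 2) * (L2 + Lk) + δ * ((s - α) * Lk) + (α - s) * (2 * L2 + Lk)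
      ≤ (1 - δ) * (2 * α ^ 2 / ζ * L2) + (1 - δ) * (α * (Ld + Lm))) :
    cz + (ζ + 1 / 2) * (L2 + Lk) + δ * (c1 + (s - α) * Lk) + (1 - δ) * (c0 - α * Lm)
      ≤ c1 + (s - α) * Ln := by
  have hδ : 0 < 1 - δ := by linarith
  have key : cz + (1 - δ) * (c0 + 2 * α ^ 2 / ζ * L2 + α * Ld) ≤ (1 - δ) * c1 := by
    rcases le_total cz 0 with h | h
    · have := mul_le_mul_of_nonneg_left hc1 hδ.le
      linarith
    · have h2 := mul_le_mul_of_nonneg_left hc2 hδ.le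
      have h3 : cz ≤ (1 - δ) * (s / ζ * cz) := by
        have : 1 ≤ (1 - δ) * s / ζ := by rw [le_div_iff₀ hζ]; linarith
        have := mul_le_mul_of_nonneg_right this h
        calc cz = 1 * cz := by ring
          _ ≤ _ := this
          _ = _ := by ring
      nlinarith
  have h4 := mul_le_mul_of_nonneg_left hLn (by linarith : 0 ≤ α - s)
  nlinarith

lemma aux_caseA (α ζ s δ L2 Lk Lm Ld : ℝ)
    (hζ : 0 < ζ) (hαs : s < α) (hδ1 : δ < 1)  (hL2 : 0 ≤ L2) (hLk : 0 ≤ Lk)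
    (hs : ζ + 1 / 2 ≤ s)
    (h1 : ζ + 1 / 2 ≤ (1 - δ) * s)
    (hm : Lk - L2 ≤ Ld + Lm) :
    (ζ + 1 / 2) * (L2 + Lk) + δ * ((s - α) * Lk) + (α - s) * (2 * L2 + Lk)
      ≤ (1 - δ) * (2 * α ^ 2 / ζ * L2) + (1 - δ) * (α * (Ld + Lm)) := by
  have hα : 0 < α := by linarith
  have hδ : 0 < 1 - δ := by linarith
  have h2 := mul_le_mul_of_nonneg_left (mul_le_mul_of_nonneg_left hm hα.le) hδ.le
  have h3 : 0 ≤ ((1 - δ) * s - (ζ + 1 / 2)) * Lk := mul_nonneg (by linarith) hLk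
  have hp : ζ + 1 / 2 ≤ (1 - δ) * α := by nlinarith
  have h4 : (1 - δ) * α + (ζ + 1 / 2) + 2 * (α - s) ≤ (1 - δ) * (2 * α ^ 2 / ζ) := by
    have : (1 - δ) * (2 * α ^ 2 / ζ) = ((1 - δ) * α) * (2 * α) / ζ := by ring
    rw [this, le_div_iff₀ hζ]
    nlinarith
  have h5 := mul_le_mul_of_nonneg_right h4 hL2
  nlinarith

lemma aux_caseB (α ζ s δ L2 Lk Ld : ℝ)
    (hζ : 0 < ζ) (hαs : s < α) (hδ1 : δ < 1)  (hL2 : 0 ≤ L2) (hLk : 0 ≤ Lk)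
    (hs : ζ + 1 / 2 ≤ s)
    (h1 : ζ ≤ (1 - δ) * s)
    (hk : δ * Lk ≤ L2)
    (hm : Lk ≤ Ld) :
    (ζ + 1 / 2) * (L2 + Lk) + δ * ((s - α) * Lk) + (α - s) * (2 * L2 + Lk)
      ≤ (1 - δ) * (2 * α ^ 2 / ζ * L2) + (1 - δ) * (α * (Ld + 0)) := by
  have hα : 0 < α := by linarith
  have hδ : 0 < 1 - δ := by linarith
  have h2 := mul_le_mul_of_nonneg_left (mul_le_mul_of_nonneg_left hm hα.le) hδ.le
  have h3 : 0 ≤ (s - (ζ + 1 / 2)) * Lk := mul_nonneg (by linarith) hLk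
  have h6 := mul_le_mul_of_nonneg_left hk (by linarith : 0 ≤ s)
  have hp : ζ ≤ (1 - δ) * α := by nlinarith
  have h4 : 2 * α ≤ (1 - δ) * (2 * α ^ 2 / ζ) := by
    have : (1 - δ) * (2 * α ^ 2 / ζ) = ((1 - δ) * α) * (2 * α) / ζ := by ring
    rw [this, le_div_iff₀ hζ]
    nlinarith
  have h5 := mul_le_mul_of_nonneg_right h4 hL2
  have h7 : 0 ≤ (s - (ζ + 1 / 2)) * L2 := mul_nonneg (by linarith) hL2
  nlinarith

/-- From the logarithmic inequality back to the recursion estimate. -/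
lemma aux_exp (t td T C0 C1 Cz α ζ s δ k m n : ℝ) (ht0 : 0 ≤ t) (hd0 : 0 ≤ td)
    (hC0 : 0 < C0) (hC1 : 0 < C1) (hCz : 0 < Cz) (hk : 0 < k) (hm : 0 < m) (hn : 0 < n)
    (hδ : 0 ≤ δ) (hδ1 : δ < 1)
    (ht : t ≤ C1 * k ^ (s - α)) (htd : td ≤ C0 * m ^ (-α))
    (hT : T ≤ Real.sqrt (2 * k) * Cz * (2 * k) ^ ζ * t ^ δ * td ^ (1 - δ))
    (hlog : Real.log Cz + (ζ + 1 / 2) * (Real.log 2 + Real.log k)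
      + δ * (Real.log C1 + (s - α) * Real.log k) + (1 - δ) * (Real.log C0 - α * Real.log m)
      ≤ Real.log C1 + (s - α) * Real.log n) :
    T ≤ C1 * n ^ (s - α) := by
  have h1 : t ^ δ ≤ (C1 * k ^ (s - α)) ^ δ := Real.rpow_le_rpow ht0 ht hδ
  have h2 : td ^ (1 - δ) ≤ (C0 * m ^ (-α)) ^ (1 - δ) := Real.rpow_le_rpow hd0 htd (by linarith)
  have h3 : T ≤ Real.sqrt (2 * k) * Cz * (2 * k) ^ ζ * (C1 * k ^ (s - α)) ^ δ
      * (C0 * m ^ (-α)) ^ (1 - δ) := hT.trans (by gcongr)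
  refine h3.trans ?_
  have pk : 0 < k ^ (s - α) := Real.rpow_pos_of_pos hk _
  have pm : 0 < m ^ (-α) := Real.rpow_pos_of_pos hm _
  have pn : 0 < n ^ (s - α) := Real.rpow_pos_of_pos hn _
  have p1 : 0 < C1 * k ^ (s - α) := by positivity
  have p2 : 0 < C0 * m ^ (-α) := by positivity
  have q1 : 0 < (C1 * k ^ (s - α)) ^ δ := Real.rpow_pos_of_pos p1 _
  have q2 : 0 < (C0 * m ^ (-α)) ^ (1 - δ) := Real.rpow_pos_of_pos p2 _
  have q3 : 0 < (2 * k) ^ ζ := Real.rpow_pos_of_pos (by positivity) _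
  have q4 : 0 < Real.sqrt (2 * k) := Real.sqrt_pos.mpr (by positivity)
  rw [← Real.log_le_log_iff (by positivity) (by positivity)]
  rw [Real.log_mul (by positivity) q2.ne', Real.log_mul (by positivity) q1.ne',
    Real.log_mul (by positivity) q3.ne', Real.log_mul q4.ne' hCz.ne',
    Real.log_rpow p2, Real.log_rpow p1, Real.log_rpow (by positivity), Real.log_sqrt (by positivity),
    Real.log_mul hC1.ne' pk.ne', Real.log_mul hC0.ne' pm.ne', Real.log_mul hC1.ne' pn.ne',
    Real.log_rpow hk, Real.log_rpow hm, Real.log_rpow hn, Real.log_mul two_ne_zero hk.ne']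
  linarith

theorem stmt_8 (τ d : ℕ → ℝ) (C₀ Cζ α ζ : ℝ)
    (hτ0 : ∀ n, 0 ≤ τ n) (hτ1 : ∀ n, τ n ≤ 1)
    (hmono : ∀ m n : ℕ, m ≤ n → τ n ≤ τ m)
    (hd0 : ∀ n, 0 ≤ d n)
    (hC₀ : 0 < C₀) (hCζ : 0 < Cζ) (hα : 0 < α) (hζ : 0 < ζ)
    (hd : ∀ n : ℕ, 1 ≤ n → d n ≤ C₀ * (n : ℝ) ^ (-α))
    (hrec : ∀ n m : ℕ, 2 ≤ n → 1 ≤ m → m < n →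
      τ (2 * n) ≤ Real.sqrt (2 * n) * Cζ * ((2 * n : ℕ) : ℝ) ^ ζ *
        (τ n) ^ ((m : ℝ) / n) * (d m) ^ (1 - (m : ℝ) / n)) :
    ∀ β : ℝ, 1 / 2 < β →
      ∀ n : ℕ, 1 ≤ n →
        τ n ≤ max
            (C₀ * (2 : ℝ) ^ (2 * α ^ 2 / ζ) * ((ζ + β) / (β - 1 / 2)) ^ α *
              max 1 (Cζ ^ ((ζ + β) / ζ)))
            ((Finset.Icc 1 (2 * ⌊2 * (ζ + β)⌋₊ + 1)).sup'
              (Finset.nonempty_Icc.mpr (by omega))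
              (fun k : ℕ => (k : ℝ) ^ (α - ζ - β))) *
          (n : ℝ) ^ (-α + ζ + β) := by
  intro β hβ n hn
  set A := C₀ * (2 : ℝ) ^ (2 * α ^ 2 / ζ) * ((ζ + β) / (β - 1 / 2)) ^ α *
              max 1 (Cζ ^ ((ζ + β) / ζ)) with hA
  set B := ((Finset.Icc 1 (2 * ⌊2 * (ζ + β)⌋₊ + 1)).sup'
              (Finset.nonempty_Icc.mpr (by omega))
              (fun k : ℕ => (k : ℝ) ^ (α - ζ - β))) with hB
  have hBk : ∀ k : ℕ, 1 ≤ k → k ≤ 2 * ⌊2 * (ζ + β)⌋₊ + 1 → (k : ℝ) ^ (α - ζ - β) ≤ B := by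
    intro k h1 h2
    exact Finset.le_sup' (fun k : ℕ => (k : ℝ) ^ (α - ζ - β)) (Finset.mem_Icc.mpr ⟨h1, h2⟩)
  set C1 := max A B with hC1
  have hAC : A ≤ C1 := le_max_left _ _
  have hBC : B ≤ C1 := le_max_right _ _
  have hC1one : 1 ≤ C1 := by
    have := hBk 1 le_rfl (by omega)
    simp only [Nat.cast_one, Real.one_rpow] at this
    linarith
  have hC1pos : 0 < C1 := by linarith
  obtain ⟨s, hs⟩ : ∃ s, s = ζ + β := ⟨_, rfl⟩
  have hexp : -α + ζ + β = s - α := by rw [hs]; ring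
  rw [hexp]
  rcases le_or_gt α s with hαs | hαs
  · have h1 : (1 : ℝ) ≤ (n : ℝ) ^ (s - α) :=
      Real.one_le_rpow (by exact_mod_cast hn) (by linarith)
    nlinarith [hτ1 n]
  have hb : 0 < β - 1 / 2 := by linarith
  have hspos : 0 < s := by linarith
  have hsz : ζ + 1 / 2 ≤ s := by linarith
  -- logarithm of the constant
  have hq : 0 < s / (β - 1 / 2) := by positivity
  have pq : 0 < (s / (β - 1 / 2)) ^ α := Real.rpow_pos_of_pos hq _
  have p2 : (0 : ℝ) < 2 ^ (2 * α ^ 2 / ζ) := Real.rpow_pos_of_pos two_pos _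
  have pz : 0 < Cζ ^ (s / ζ) := Real.rpow_pos_of_pos hCζ _
  have base : Real.log (C₀ * (2 : ℝ) ^ (2 * α ^ 2 / ζ) * (s / (β - 1 / 2)) ^ α)
      = Real.log C₀ + 2 * α ^ 2 / ζ * Real.log 2 + α * Real.log (s / (β - 1 / 2)) := by
    rw [Real.log_mul (by positivity) pq.ne', Real.log_mul hC₀.ne' p2.ne', Real.log_rpow hq,
      Real.log_rpow two_pos]
  have hc1 : Real.log C₀ + 2 * α ^ 2 / ζ * Real.log 2 + α * Real.log (s / (β - 1 / 2))
      ≤ Real.log C1 := by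
    rw [← base]
    refine Real.log_le_log (by positivity) (le_trans ?_ hAC)
    rw [hA, ← hs]
    exact le_mul_of_one_le_right (by positivity) (le_max_left _ _)
  have hc2 : Real.log C₀ + 2 * α ^ 2 / ζ * Real.log 2 + α * Real.log (s / (β - 1 / 2))
      + s / ζ * Real.log Cζ ≤ Real.log C1 := by
    rw [← base, ← Real.log_rpow hCζ, ← Real.log_mul (by positivity) pz.ne']
    refine Real.log_le_log (by positivity) (le_trans ?_ hAC)
    rw [hA, ← hs]
    exact mul_le_mul_of_nonneg_left (le_max_right _ _) (by positivity)
  have hL2 : 0 ≤ Real.log 2 := Real.log_nonneg (by norm_num)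
  clear hC1 hB hA
  clear_value C1 B A
  induction n using Nat.strong_induction_on with
  | _ n ih =>
  rcases Nat.lt_or_ge (2 * ⌊2 * (ζ + β)⌋₊ + 1) n with hlarge | hsmall
  swap
  · have h1 := (hBk n hn hsmall).trans hBC
    have hnpos : (0 : ℝ) < n := by exact_mod_cast hn
    have h2 : (n : ℝ) ^ (α - ζ - β) * (n : ℝ) ^ (s - α) = 1 := by
      rw [← Real.rpow_add hnpos, hs]
      ring_nf
      exact Real.rpow_zero _
    have h3 := mul_le_mul_of_nonneg_right h1 (Real.rpow_nonneg hnpos.le (s - α))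
    rw [h2] at h3
    exact (hτ1 n).trans h3
  obtain ⟨k, hk⟩ : ∃ k, k = n / 2 := ⟨_, rfl⟩
  have hkfl : ⌊2 * (ζ + β)⌋₊ < k := by omega
  have hks : 2 * s < k := by
    rw [hs]; exact (Nat.floor_lt (by linarith)).mp hkfl
  have hk1 : (1 : ℝ) < k := by linarith
  have hk2 : 2 ≤ k := by exact_mod_cast (show 1 < k by exact_mod_cast hk1)
  have hkpos : (0 : ℝ) < k := by linarith
  have hnpos : (0 : ℝ) < n := by exact_mod_cast hn
  have hLk : 0 ≤ Real.log k := Real.log_nonneg hk1.le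
  have ihk := ih k (by omega) (by omega)
  have hτn : τ n ≤ τ (2 * k) := hmono _ _ (by omega)
  refine hτn.trans ?_
  have hLn : Real.log n ≤ 2 * Real.log 2 + Real.log k := by
    have h4 : (n : ℝ) ≤ 2 * (2 * k) := by exact_mod_cast (show n ≤ 2 * (2 * k) by omega)
    have := Real.log_le_log hnpos h4
    rw [Real.log_mul two_ne_zero (by positivity), Real.log_mul two_ne_zero hkpos.ne'] at this
    linarith
  have main : ∀ m : ℕ, 1 ≤ m → m < k → ζ ≤ (1 - (m : ℝ) / k) * s →
      ((ζ + 1 / 2) * (Real.log 2 + Real.log k) + (m : ℝ) / k * ((s - α) * Real.log k)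
        + (α - s) * (2 * Real.log 2 + Real.log k)
      ≤ (1 - (m : ℝ) / k) * (2 * α ^ 2 / ζ * Real.log 2)
        + (1 - (m : ℝ) / k) * (α * (Real.log (s / (β - 1 / 2)) + Real.log m))) →
      τ (2 * k) ≤ C1 * (n : ℝ) ^ (s - α) := by
    intro m hm1 hmk h1 hR
    have hδ1 : (m : ℝ) / k < 1 := by
      rw [div_lt_one hkpos]; exact_mod_cast hmk
    have hmpos : (0 : ℝ) < m := by exact_mod_cast hm1
    have hT := hrec k m hk2 hm1 hmk
    push_cast at hT
    exact aux_exp (τ k) (d m) (τ (2 * k)) C₀ C1 Cζ α ζ s ((m : ℝ) / k) k m n (hτ0 k) (hd0 m)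
      hC₀ hC1pos hCζ hkpos hmpos hnpos (by positivity) hδ1 ihk (hd m hm1) hT
      (aux_step α ζ s _ _ _ _ _ _ _ _ _ hζ hαs hδ1 h1 hc1 hc2 hLn hR)
  rcases le_or_gt (s / (β - 1 / 2)) k with hcase | hcase
  · -- main case
    have hx : 1 ≤ (β - 1 / 2) / s * k := by
      rw [div_le_iff₀ hb] at hcase
      rw [div_mul_eq_mul_div, le_div_iff₀ hspos]; linarith
    obtain ⟨m, hm⟩ : ∃ m, m = ⌊(β - 1 / 2) / s * k⌋₊ := ⟨_, rfl⟩
    have hm1 : 1 ≤ m := by rw [hm]; exact Nat.one_le_floor_iff _ |>.mpr hx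
    have hmle : (m : ℝ) ≤ (β - 1 / 2) / s * k := by rw [hm]; exact Nat.floor_le (by linarith)
    have hmlt : (β - 1 / 2) / s * k < m + 1 := by rw [hm]; exact Nat.lt_floor_add_one _
    have hm1' : (1 : ℝ) ≤ m := by exact_mod_cast hm1
    have hmδ : (m : ℝ) / k ≤ (β - 1 / 2) / s := by rw [div_le_iff₀ hkpos]; exact hmle
    have hδ01 : (β - 1 / 2) / s < 1 := by rw [div_lt_one hspos]; linarith
    have hδ1 : (m : ℝ) / k < 1 := by linarith
    have hmk : m < k := by
      rw [div_lt_one hkpos] at hδ1; exact_mod_cast hδ1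
    have h1 : ζ + 1 / 2 ≤ (1 - (m : ℝ) / k) * s := by
      rw [le_div_iff₀ hspos] at hmδ; linarith
    refine main m hm1 hmk (by linarith) (aux_caseA α ζ s _ _ _ _ _ hζ hαs hδ1 hL2 hLk hsz h1 ?_)
    have h2 : (k : ℝ) ≤ 2 * (s / (β - 1 / 2) * m) := by
      have h3 : (β - 1 / 2) / s * k ≤ 2 * m := by linarith
      rw [div_mul_eq_mul_div, div_le_iff₀ hspos] at h3
      have h4 : 2 * (s / (β - 1 / 2) * m) = (2 * m * s) / (β - 1 / 2) := by ring
      rw [h4, le_div_iff₀ hb]; linarith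
    have h5 := Real.log_le_log hkpos h2
    rw [Real.log_mul two_ne_zero (by positivity), Real.log_mul hq.ne' (by positivity)] at h5
    linarith
  · have hδ1 : ((1 : ℕ) : ℝ) / k < 1 := by
      rw [div_lt_one hkpos]; exact_mod_cast hk1
    have h1 : ζ ≤ (1 - ((1 : ℕ) : ℝ) / k) * s := by
      have : s / k < 1 / 2 := by rw [div_lt_iff₀ hkpos]; linarith
      have h2 : (1 - ((1 : ℕ) : ℝ) / k) * s = s - s / k := by push_cast; ring
      rw [h2]; linarith
    refine main 1 le_rfl (by omega) h1 ?_
    have h3 := Real.log_le_log hkpos hcase.le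
    have h4 : ((1 : ℕ) : ℝ) / k * Real.log k ≤ Real.log 2 := by
      have h5 : (k : ℝ) ≤ 2 ^ k := by exact_mod_cast Nat.lt_two_pow_self.le
      have h6 := Real.log_le_log hkpos h5
      rw [Real.log_pow] at h6
      rw [div_mul_eq_mul_div, div_le_iff₀ hkpos]
      push_cast; linarith
    have := aux_caseB α ζ s _ _ _ _ hζ hαs hδ1 hL2 hLk hsz h1 h4 h3
    simpa using this
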